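/- Let X be a centered Gaussian random vector in ℝ^d (multivariate normal with mean 0 and covariance matrix R), and let A = {α₁,…,α_{2N}} be a multiset of 2N indices with 1 ≤ α_i ≤ d for all i. Then E[X_A] = ∑_{σ∈Π(A)} ∏_{pairs (i,j) of σ} E[X_{α_i} X_{α_j}], i.e., the expectation of the product X_{α₁}⋯X_{α_{2N}} equals the sum over all pairings of A of the product of the pairwise covariances. -/

import Mathlib

open MeasureTheory ProbabilityTheory Matrix Finset
open scoped Classical

/-- The centered `d`-variate Gaussian density with covariance matrix `R`:
`φ_R(x) = |2πR|^{-1/2} exp(-½ xᵀ R⁻¹ x)`. -/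
noncomputable def gaussianPdf {d : ℕ} (R : Matrix (Fin d) (Fin d) ℝ) (x : Fin d → ℝ) : ℝ :=
  (Real.sqrt ((2 * Real.pi) ^ d * R.det))⁻¹ * Real.exp (-(x ⬝ᵥ (R⁻¹ *ᵥ x)) / 2)

/-- The centered Gaussian measure on `ℝ^d` with (positive definite) covariance matrix `R`. -/
noncomputable def gaussianMeasure {d : ℕ} (R : Matrix (Fin d) (Fin d) ℝ) :
    Measure (Fin d → ℝ) :=
  volume.withDensity fun x => ENNReal.ofReal (gaussianPdf R x)

/-- Pairings of a finite set `B` of index positions, encoded as fixed-point-free (on `B`)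
involutions of `Fin m` that fix the complement of `B` pointwise. -/
noncomputable def pairingsOn {m : ℕ} (B : Finset (Fin m)) : Finset (Equiv.Perm (Fin m)) :=
  Finset.univ.filter fun σ =>
    (∀ i, σ (σ i) = i) ∧ (∀ i ∈ B, σ i ≠ i ∧ σ i ∈ B) ∧ ∀ i ∉ B, σ i = i

/-- The Isserlis pairing sum `∑_{σ∈Π(B)} ∏_{pairs (i,j) of σ} C (α i) (α j)` over the
set `B` of index positions, where `C i j` stands for the second moment `E[X_i X_j]`. -/
noncomputable def pairSum {d m : ℕ} (C : Fin d → Fin d → ℝ) (α : Fin m → Fin d)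
    (B : Finset (Fin m)) : ℝ :=
  ∑ σ ∈ pairingsOn B, ∏ i ∈ B.filter (fun i => i < σ i), C (α i) (α (σ i))

theorem exists_pos_mul_sum_sq_le_of_posDef {d : ℕ} {M : Matrix (Fin d) (Fin d) ℝ}
    (hM : M.PosDef) : ∃ c : ℝ, 0 < c ∧ ∀ x : Fin d → ℝ, c * ∑ i, x i ^ 2 ≤ x ⬝ᵥ (M *ᵥ x) := by
  have hcont : Continuous fun x : Fin d → ℝ => x ⬝ᵥ (M *ᵥ x) := by fun_prop
  have hpos : ∀ x : Fin d → ℝ, x ≠ 0 → 0 < x ⬝ᵥ (M *ᵥ x) := fun x hx => by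
    simpa using hM.dotProduct_mulVec_pos hx
  rcases (Metric.sphere (0 : Fin d → ℝ) 1).eq_empty_or_nonempty with hS | hS
  · refine ⟨1, one_pos, fun x => ?_⟩
    have hx : x = 0 := by
      by_contra hx
      have : ‖x‖⁻¹ • x ∈ Metric.sphere (0 : Fin d → ℝ) 1 := by
        simp [norm_smul, inv_mul_cancel₀ (norm_ne_zero_iff.2 hx)]
      simp [hS] at this
    simp [hx]
  obtain ⟨y, hy, hmin⟩ := (isCompact_sphere (0 : Fin d → ℝ) 1).exists_isMinOn hS
    hcont.continuousOn
  have hy0 : y ≠ 0 := by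
    rintro rfl
    simp at hy
  set m := y ⬝ᵥ (M *ᵥ y) with hm
  have hm0 : 0 < m := hpos y hy0
  have hquad : ∀ x : Fin d → ℝ, m * ‖x‖ ^ 2 ≤ x ⬝ᵥ (M *ᵥ x) := by
    intro x
    by_cases hx : x = 0
    · simp [hx]
    have hn : ‖x‖ ≠ 0 := norm_ne_zero_iff.2 hx
    have hmem : ‖x‖⁻¹ • x ∈ Metric.sphere (0 : Fin d → ℝ) 1 := by
      simp [norm_smul, inv_mul_cancel₀ hn]
    have h : m ≤ (‖x‖⁻¹ • x) ⬝ᵥ (M *ᵥ (‖x‖⁻¹ • x)) := hmin hmem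
    rw [mulVec_smul, smul_dotProduct, dotProduct_smul, smul_eq_mul, smul_eq_mul] at h
    calc m * ‖x‖ ^ 2 ≤ (‖x‖⁻¹ * (‖x‖⁻¹ * (x ⬝ᵥ (M *ᵥ x)))) * ‖x‖ ^ 2 := by gcongr
      _ = x ⬝ᵥ (M *ᵥ x) := by field_simp
  refine ⟨m / (d + 1), by positivity, fun x => le_trans ?_ (hquad x)⟩
  have hsum : ∑ i, x i ^ 2 ≤ (d + 1) * ‖x‖ ^ 2 := by
    calc ∑ i, x i ^ 2 ≤ ∑ _i : Fin d, ‖x‖ ^ 2 := by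
          refine Finset.sum_le_sum fun i _ => ?_
          rw [← sq_abs]
          gcongr
          exact norm_le_pi_norm x i
      _ = d * ‖x‖ ^ 2 := by simp
      _ ≤ (d + 1) * ‖x‖ ^ 2 := by gcongr; linarith
  calc m / (d + 1) * ∑ i, x i ^ 2 ≤ m / (d + 1) * ((d + 1) * ‖x‖ ^ 2) := by gcongr
    _ = m * ‖x‖ ^ 2 := by field_simp

theorem integrable_monomial_mul_exp_neg_mul_sum_sq {d : ℕ} {c : ℝ} (hc : 0 < c) (n : Fin d → ℕ) :
    Integrable fun x : Fin d → ℝ => (∏ i, x i ^ n i) * Real.exp (-(c * ∑ i, x i ^ 2)) := by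
  have h1 : ∀ i : Fin d, Integrable fun t : ℝ => t ^ n i * Real.exp (-c * t ^ 2) := fun i => by
    simpa using integrable_rpow_mul_exp_neg_mul_sq hc
      (s := n i) (by have : (0 : ℝ) ≤ n i := Nat.cast_nonneg _
                     linarith)
  have h2 := Integrable.fintype_prod h1
  refine h2.congr (.of_forall fun x => ?_)
  simp only [Finset.prod_mul_distrib, ← Real.exp_sum, Finset.mul_sum, neg_mul,
    Finset.sum_neg_distrib]

theorem integrable_prod_mul_exp_neg_dotProduct {d : ℕ} {ι : Type*}
    {M : Matrix (Fin d) (Fin d) ℝ} (hM : M.PosDef) (B : Finset ι) (α : ι → Fin d) :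
    Integrable fun x : Fin d → ℝ =>
      (∏ k ∈ B, x (α k)) * Real.exp (-(x ⬝ᵥ (M *ᵥ x)) / 2) := by
  obtain ⟨c, hc, hle⟩ := exists_pos_mul_sum_sq_le_of_posDef hM
  refine (integrable_monomial_mul_exp_neg_mul_sum_sq (half_pos hc)
    fun i => #{k ∈ B | α k = i}).mono (by fun_prop) (.of_forall fun x => ?_)
  have hprod : ∏ k ∈ B, x (α k) = ∏ i, x i ^ #{k ∈ B | α k = i} := by
    rw [← Finset.prod_fiberwise B α]
    refine Finset.prod_congr rfl fun i _ => Finset.prod_eq_pow_card fun k hk => ?_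
    rw [(Finset.mem_filter.1 hk).2]
  rw [hprod, norm_mul, norm_mul, Real.norm_of_nonneg (Real.exp_pos _).le,
    Real.norm_of_nonneg (Real.exp_pos _).le]
  gcongr
  linarith [hle x]

theorem hasLineDerivAt_exp_neg_dotProduct_inv {d : ℕ} {R : Matrix (Fin d) (Fin d) ℝ}
    (hR : R.PosDef) (a : Fin d) (x : Fin d → ℝ) :
    HasLineDerivAt ℝ (fun x : Fin d → ℝ => Real.exp (-(x ⬝ᵥ (R⁻¹ *ᵥ x)) / 2))
      (-(x a * Real.exp (-(x ⬝ᵥ (R⁻¹ *ᵥ x)) / 2))) x (R.col a) := by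
  have hv : R⁻¹ *ᵥ R.col a = Pi.single a 1 := by
    rw [← mulVec_single_one, mulVec_mulVec,
      nonsing_inv_mul _ ((isUnit_iff_isUnit_det R).1 hR.isUnit), one_mulVec]
  have hsymm : (R⁻¹)ᵀ = R⁻¹ := by simpa [IsHermitian] using hR.inv.isHermitian
  have hv' : R.col a ⬝ᵥ (R⁻¹ *ᵥ x) = x a := by
    rw [dotProduct_mulVec, ← mulVec_transpose, hsymm, hv, single_dotProduct, one_mul]
  have hexp : ∀ t : ℝ, (x + t • R.col a) ⬝ᵥ (R⁻¹ *ᵥ (x + t • R.col a)) =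
      x ⬝ᵥ (R⁻¹ *ᵥ x) + 2 * t * x a + t ^ 2 * R.col a a := by
    intro t
    simp only [mulVec_add, mulVec_smul, hv, add_dotProduct, dotProduct_add, smul_dotProduct,
      dotProduct_smul, hv', dotProduct_single, smul_eq_mul, Pi.add_apply, Pi.smul_apply]
    ring
  unfold HasLineDerivAt
  simp only [hexp]
  have h : HasDerivAt (fun t : ℝ =>
      -(x ⬝ᵥ (R⁻¹ *ᵥ x) + 2 * t * x a + t ^ 2 * R.col a a) / 2) (-x a) 0 := by
    have h2 : HasDerivAt (fun t : ℝ => 2 * t * x a) (2 * 1 * x a) 0 :=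
      ((hasDerivAt_id (0 : ℝ)).const_mul 2).mul_const _
    have h3 : HasDerivAt (fun t : ℝ => t ^ 2 * R.col a a) (_ * R.col a a) 0 :=
      (hasDerivAt_pow 2 (0 : ℝ)).mul_const _
    exact (((h2.const_add _).add h3).neg.div_const 2).congr_deriv (by simp; ring)
  exact h.exp.congr_deriv (by simp [mul_comm])

theorem hasLineDerivAt_prod_coord {d : ℕ} {ι : Type*} [DecidableEq ι] (B : Finset ι) (α : ι → Fin d)
    (x v : Fin d → ℝ) :
    HasLineDerivAt ℝ (fun x : Fin d → ℝ => ∏ k ∈ B, x (α k))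
      (∑ k ∈ B, v (α k) * ∏ l ∈ B.erase k, x (α l)) x v := by
  have h : ∀ k ∈ B, HasDerivAt (fun t : ℝ => (x + t • v) (α k)) (v (α k)) 0 := fun k _ => by
    simpa using ((hasDerivAt_id (0 : ℝ)).mul_const (v (α k))).const_add (x (α k))
  refine (HasDerivAt.fun_finsetProd h).congr_deriv (Finset.sum_congr rfl fun k _ => ?_)
  simp [mul_comm]

theorem integral_mul_prod_mul_exp {d : ℕ} {ι : Type*} [DecidableEq ι]
    {R : Matrix (Fin d) (Fin d) ℝ} (hR : R.PosDef) {B : Finset ι} (α : ι → Fin d)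
    {j : ι} (hj : j ∉ B) :
    ∫ x : Fin d → ℝ, (∏ k ∈ insert j B, x (α k)) * Real.exp (-(x ⬝ᵥ (R⁻¹ *ᵥ x)) / 2) =
      ∑ k ∈ B, R (α j) (α k) *
        ∫ x : Fin d → ℝ, (∏ l ∈ B.erase k, x (α l)) * Real.exp (-(x ⬝ᵥ (R⁻¹ *ᵥ x)) / 2) := by
  have hint := fun C : Finset ι => integrable_prod_mul_exp_neg_dotProduct hR.inv C α
  have hf'g : (fun x : Fin d → ℝ => (∑ k ∈ B, R.col (α j) (α k) * ∏ l ∈ B.erase k, x (α l)) *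
      Real.exp (-(x ⬝ᵥ (R⁻¹ *ᵥ x)) / 2)) = fun x => ∑ k ∈ B, R.col (α j) (α k) *
      ((∏ l ∈ B.erase k, x (α l)) * Real.exp (-(x ⬝ᵥ (R⁻¹ *ᵥ x)) / 2)) := by
    simp only [Finset.sum_mul, mul_assoc]
  have hfg' : (fun x : Fin d → ℝ => (∏ k ∈ B, x (α k)) *
      -(x (α j) * Real.exp (-(x ⬝ᵥ (R⁻¹ *ᵥ x)) / 2))) = fun x =>
      -((∏ k ∈ insert j B, x (α k)) * Real.exp (-(x ⬝ᵥ (R⁻¹ *ᵥ x)) / 2)) := by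
    funext x
    rw [Finset.prod_insert hj]
    ring
  have hint' : ∀ k ∈ B, Integrable fun x : Fin d → ℝ => R.col (α j) (α k) *
      ((∏ l ∈ B.erase k, x (α l)) * Real.exp (-(x ⬝ᵥ (R⁻¹ *ᵥ x)) / 2)) :=
    fun k _ => (hint (B.erase k)).const_mul _
  have h := integral_bilinear_hasLineDerivAt_right_eq_neg_left_of_integrable
    (μ := (volume : Measure (Fin d → ℝ))) (B := ContinuousLinearMap.mul ℝ ℝ)
    (f' := fun x => ∑ k ∈ B, R.col (α j) (α k) * ∏ l ∈ B.erase k, x (α l))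
    (g' := fun x => -(x (α j) * Real.exp (-(x ⬝ᵥ (R⁻¹ *ᵥ x)) / 2)))
    (by
      simp only [ContinuousLinearMap.mul_apply', hf'g]
      exact integrable_finsetSum _ hint')
    (by
      simp only [ContinuousLinearMap.mul_apply', hfg']
      exact (hint _).neg)
    (by
      simp only [ContinuousLinearMap.mul_apply']
      exact hint B)
    (fun x _ => hasLineDerivAt_prod_coord B α x _)
    (fun x _ => hasLineDerivAt_exp_neg_dotProduct_inv hR (α j) x)
  simp only [ContinuousLinearMap.mul_apply', hf'g, hfg'] at h
  rw [integral_neg, neg_inj, integral_finsetSum _ hint'] at h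
  rw [h]
  refine Finset.sum_congr rfl fun k _ => ?_
  rw [integral_const_mul]
  congr 1
  simpa using hR.isHermitian.apply (α j) (α k)

theorem integral_gaussianMeasure {d : ℕ} (R : Matrix (Fin d) (Fin d) ℝ) (F : (Fin d → ℝ) → ℝ) :
    ∫ x, F x ∂gaussianMeasure R = (Real.sqrt ((2 * Real.pi) ^ d * R.det))⁻¹ *
      ∫ x, F x * Real.exp (-(x ⬝ᵥ (R⁻¹ *ᵥ x)) / 2) := by
  have hmeas : Measurable (gaussianPdf R) := by
    unfold gaussianPdf
    have : Continuous fun x : Fin d → ℝ => x ⬝ᵥ (R⁻¹ *ᵥ x) := by fun_prop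
    fun_prop
  rw [gaussianMeasure, integral_withDensity_eq_integral_toReal_smul hmeas.ennreal_ofReal
    (.of_forall fun _ => ENNReal.ofReal_lt_top), ← integral_const_mul]
  refine integral_congr_ae (.of_forall fun x => ?_)
  have : 0 ≤ gaussianPdf R x := by unfold gaussianPdf; positivity
  simp only [ENNReal.toReal_ofReal this, smul_eq_mul]
  rw [gaussianPdf]
  ring

theorem integral_prod_insert_gaussianMeasure {d : ℕ} {ι : Type*} [DecidableEq ι]
    {R : Matrix (Fin d) (Fin d) ℝ} (hR : R.PosDef) {B : Finset ι} (α : ι → Fin d)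
    {j : ι} (hj : j ∉ B) :
    ∫ x, ∏ k ∈ insert j B, x (α k) ∂gaussianMeasure R =
      ∑ k ∈ B, R (α j) (α k) * ∫ x, ∏ l ∈ B.erase k, x (α l) ∂gaussianMeasure R := by
  simp only [integral_gaussianMeasure, integral_mul_prod_mul_exp hR α hj, Finset.mul_sum]
  exact Finset.sum_congr rfl fun k _ => by ring

theorem integral_mul_gaussianMeasure {d : ℕ} {R : Matrix (Fin d) (Fin d) ℝ} (hR : R.PosDef)
    [IsProbabilityMeasure (gaussianMeasure R)] (i j : Fin d) :
    ∫ x, x i * x j ∂gaussianMeasure R = R i j := by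
  have h := integral_prod_insert_gaussianMeasure hR (B := {(1 : Fin 2)}) ![i, j] (j := 0) (by simp)
  simpa using h

theorem pairSum_empty {d m : ℕ} (C : Fin d → Fin d → ℝ) (α : Fin m → Fin d) :
    pairSum C α ∅ = 1 := by
  have : pairingsOn (∅ : Finset (Fin m)) = {1} := by
    ext σ
    simp only [pairingsOn, Finset.mem_filter, Finset.mem_univ, true_and, Finset.mem_singleton,
      Finset.notMem_empty, false_imp_iff, implies_true, not_false_eq_true, forall_const]
    exact ⟨fun h => Equiv.ext h.2, by rintro rfl; simp⟩
  simp [pairSum, this]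

theorem mem_pairingsOn {m : ℕ} {B : Finset (Fin m)} {σ : Equiv.Perm (Fin m)} :
    σ ∈ pairingsOn B ↔
      (∀ i, σ (σ i) = i) ∧ (∀ i ∈ B, σ i ≠ i ∧ σ i ∈ B) ∧ ∀ i ∉ B, σ i = i := by
  simp [pairingsOn]

theorem swap_mul_mem_pairingsOn_of_mem {m : ℕ} {B : Finset (Fin m)} {j k : Fin m}
    {σ : Equiv.Perm (Fin m)} (hσ : σ ∈ pairingsOn B) (hjk : σ j = k) :
    Equiv.swap j k * σ ∈ pairingsOn ((B.erase j).erase k) := by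
  rw [mem_pairingsOn] at hσ ⊢
  obtain ⟨h1, h2, h3⟩ := hσ
  have hkj : σ k = j := hjk ▸ h1 j
  have hne : ∀ i, i ≠ j → i ≠ k → σ i ≠ j ∧ σ i ≠ k := fun i hij hik =>
    ⟨fun h => hik (by rw [← h1 i, h, hjk]), fun h => hij (by rw [← h1 i, h, hkj])⟩
  have ha : ∀ i, i ≠ j → i ≠ k → (Equiv.swap j k * σ) i = σ i := fun i hij hik =>
    Equiv.swap_apply_of_ne_of_ne (hne i hij hik).1 (hne i hij hik).2
  have hj : (Equiv.swap j k * σ) j = j := by simp [hjk]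
  have hk : (Equiv.swap j k * σ) k = k := by simp [hkj]
  refine ⟨fun i => ?_, fun i hi => ?_, fun i hi => ?_⟩
  · by_cases hij : i = j
    · rw [hij, hj, hj]
    by_cases hik : i = k
    · rw [hik, hk, hk]
    rw [ha i hij hik, ha _ (hne i hij hik).1 (hne i hij hik).2, h1]
  · simp only [Finset.mem_erase] at hi ⊢
    rw [ha i hi.2.1 hi.1]
    exact ⟨(h2 i hi.2.2).1, (hne i hi.2.1 hi.1).2, (hne i hi.2.1 hi.1).1, (h2 i hi.2.2).2⟩
  · by_cases hij : i = j
    · rw [hij, hj]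
    by_cases hik : i = k
    · rw [hik, hk]
    rw [ha i hij hik]
    exact h3 i fun h => hi (by simp [hij, hik, h])

theorem swap_mul_mem_pairingsOn {m : ℕ} {B : Finset (Fin m)} {j k : Fin m}
    (hj : j ∈ B) (hk : k ∈ B) (hjk : j ≠ k) {τ : Equiv.Perm (Fin m)}
    (hτ : τ ∈ pairingsOn ((B.erase j).erase k)) :
    Equiv.swap j k * τ ∈ pairingsOn B ∧ (Equiv.swap j k * τ) j = k ∧
      (Equiv.swap j k * τ) k = j ∧
      ∀ i ∈ (B.erase j).erase k, (Equiv.swap j k * τ) i = τ i := by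
  rw [mem_pairingsOn] at hτ ⊢
  obtain ⟨h1, h2, h3⟩ := hτ
  have hτj : τ j = j := h3 j (by simp)
  have hτk : τ k = k := h3 k (by simp)
  have hne : ∀ i, i ≠ j → i ≠ k → τ i ≠ j ∧ τ i ≠ k := fun i hij hik =>
    ⟨fun h => hij (by rw [← h1 i, h, hτj]), fun h => hik (by rw [← h1 i, h, hτk])⟩
  have ha : ∀ i, i ≠ j → i ≠ k → (Equiv.swap j k * τ) i = τ i := fun i hij hik =>
    Equiv.swap_apply_of_ne_of_ne (hne i hij hik).1 (hne i hij hik).2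
  have hj' : (Equiv.swap j k * τ) j = k := by simp [hτj]
  have hk' : (Equiv.swap j k * τ) k = j := by simp [hτk]
  refine ⟨⟨fun i => ?_, fun i hi => ?_, fun i hi => ?_⟩, hj', hk', fun i hi => ?_⟩
  · by_cases hij : i = j
    · rw [hij, hj', hk']
    by_cases hik : i = k
    · rw [hik, hk', hj']
    rw [ha i hij hik, ha _ (hne i hij hik).1 (hne i hij hik).2, h1]
  · by_cases hij : i = j
    · rw [hij, hj']
      exact ⟨hjk.symm, hk⟩
    by_cases hik : i = k
    · rw [hik, hk']
      exact ⟨hjk, hj⟩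
    rw [ha i hij hik]
    have := h2 i (by simp [hij, hik, hi])
    simp only [Finset.mem_erase] at this
    exact ⟨this.1, this.2.2.2⟩
  · have hij : i ≠ j := fun h => hi (h ▸ hj)
    have hik : i ≠ k := fun h => hi (h ▸ hk)
    rw [ha i hij hik]
    exact h3 i (by simp [hi])
  · simp only [Finset.mem_erase] at hi
    exact ha i hi.2.1 hi.1

theorem pairSum_eq_sum_erase {d m : ℕ} {C : Fin d → Fin d → ℝ} (hC : ∀ a b, C a b = C b a)
    (α : Fin m → Fin d) {B : Finset (Fin m)} {j : Fin m} (hj : j ∈ B) :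
    pairSum C α B =
      ∑ k ∈ B.erase j, C (α j) (α k) * pairSum C α ((B.erase j).erase k) := by
  have hmaps : ∀ σ ∈ pairingsOn B, σ j ∈ B.erase j := fun σ hσ => by
    have := (mem_pairingsOn.1 hσ).2.1 j hj
    simpa using this
  rw [pairSum, ← Finset.sum_fiberwise_of_maps_to hmaps]
  refine Finset.sum_congr rfl fun k hk => ?_
  obtain ⟨hkj, hkB⟩ := Finset.mem_erase.1 hk
  rw [pairSum, Finset.mul_sum]
  symm
  refine Finset.sum_bij' (fun τ _ => Equiv.swap j k * τ) (fun σ _ => Equiv.swap j k * σ)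
    (fun τ hτ => ?_) (fun σ hσ => ?_) (fun τ _ => by simp) (fun σ _ => by simp) fun τ hτ => ?_
  · obtain ⟨h1, h2, -⟩ := swap_mul_mem_pairingsOn hj hkB hkj.symm hτ
    exact Finset.mem_filter.2 ⟨h1, h2⟩
  · obtain ⟨h1, h2⟩ := Finset.mem_filter.1 hσ
    exact swap_mul_mem_pairingsOn_of_mem h1 h2
  · obtain ⟨-, h2, h3, h4⟩ := swap_mul_mem_pairingsOn hj hkB hkj.symm hτ
    set σ := Equiv.swap j k * τ
    rw [Finset.prod_filter, Finset.prod_filter, ← Finset.mul_prod_erase B _ hj,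
      ← Finset.mul_prod_erase (B.erase j) _ hk, h2, h3, ← mul_assoc]
    congr 1
    · rcases lt_or_gt_of_ne hkj with h | h
      · simp [h, h.not_gt, hC (α j)]
      · simp [h, h.not_gt]
    · exact Finset.prod_congr rfl fun i hi => by rw [h4 i hi]

theorem integral_prod_gaussianMeasure {d m : ℕ} {R : Matrix (Fin d) (Fin d) ℝ} (hR : R.PosDef)
    [IsProbabilityMeasure (gaussianMeasure R)] (α : Fin m → Fin d) (B : Finset (Fin m)) :
    ∫ x, ∏ k ∈ B, x (α k) ∂gaussianMeasure R = pairSum (fun a b => R a b) α B := by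
  induction B using Finset.strongInduction with
  | H B ih =>
    rcases B.eq_empty_or_nonempty with rfl | ⟨j, hj⟩
    · simp [pairSum_empty]
    · have hsymm : ∀ a b, R a b = R b a := fun a b => by
        simpa using hR.isHermitian.apply b a
      rw [pairSum_eq_sum_erase (C := fun a b => R a b) hsymm α hj]
      conv_lhs => rw [← Finset.insert_erase hj]
      rw [integral_prod_insert_gaussianMeasure hR α (Finset.notMem_erase j B)]
      refine Finset.sum_congr rfl fun k hk => ?_
      rw [ih _ ((Finset.erase_ssubset hk).trans (Finset.erase_ssubset hj))]

/-- **Isserlis theorem, even case**: for a centered Gaussian vector `X` in `ℝ^d` with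
covariance `R` and a multiset `A = {α₁,…,α_{2N}}` of indices,
`E[X_A] = ∑_{σ∈Π(A)} ∏_{(i,j)∈σ} E[X_{α_i} X_{α_j}]`. -/
theorem isserlis_even {d N : ℕ} {Ω : Type*} [MeasurableSpace Ω]
    (P : Measure Ω) [IsProbabilityMeasure P]
    (R : Matrix (Fin d) (Fin d) ℝ) (hR : R.PosDef)
    (X : Ω → Fin d → ℝ) (hXm : Measurable X)
    (hlaw : Measure.map X P = gaussianMeasure R)
    (α : Fin (2 * N) → Fin d) :
    ∫ ω, ∏ i, X ω (α i) ∂P =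
      pairSum (fun i j => ∫ ω, X ω i * X ω j ∂P) α Finset.univ := by
  have hprob : IsProbabilityMeasure (gaussianMeasure R) :=
    hlaw ▸ Measure.isProbabilityMeasure_map hXm.aemeasurable
  have hmap : ∀ F : (Fin d → ℝ) → ℝ, Continuous F →
      ∫ ω, F (X ω) ∂P = ∫ x, F x ∂gaussianMeasure R := fun F hF => by
    rw [← hlaw, integral_map hXm.aemeasurable hF.aestronglyMeasurable]
  have hcov : (fun i j => ∫ ω, X ω i * X ω j ∂P) = fun i j => R i j := by
    funext i j
    rw [hmap (fun x => x i * x j) (by fun_prop), integral_mul_gaussianMeasure hR]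
  rw [hcov, hmap (fun x => ∏ i, x (α i)) (by fun_prop), integral_prod_gaussianMeasure hR]
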